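/- For every rational α ∈ (0,1) and every rational β ∈ (0,1) there exist a digraph G=(V,E) with positive capacities cap and a traffic matrix T such that: T is routable in E, and for every set E' ⊆ E of minimum cardinality among all sets B ⊆ E satisfying 'for all (s,t) ∈ V×V and every value v achievable from s to t in E, the value β·v is achievable from s to t in B', the scaled matrix α·T is not routable in E'. -/

import Mathlib

open Finset

variable {V : Type*}

/-- A flow for the commodity `(s,t)` of value `d`, supported on the edge set `E`. -/
def IsFlow [Fintype V] [DecidableEq V] (E : Finset (V × V)) (s t : V) (d : ℚ)
    (f : V × V → ℚ) : Prop :=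
  (∀ e, 0 ≤ f e) ∧ (∀ e, e ∉ E → f e = 0) ∧
    ∀ v : V,
      ((∑ e ∈ E.filter (fun e => e.2 = v), f e) -
          ∑ e ∈ E.filter (fun e => e.1 = v), f e) =
        (if v = t then d else 0) - (if v = s then d else 0)

/-- The traffic matrix `T` is routable in the edge set `A ⊆ E` via a multi-commodity flow. -/
def Routable [Fintype V] [DecidableEq V] (E : Finset (V × V)) (cap : V × V → ℚ)
    (T : V × V → ℚ) (A : Finset (V × V)) : Prop :=
  ∃ f : V × V → V × V → ℚ,
    (∀ p : V × V, IsFlow E p.1 p.2 (T p) (f p)) ∧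
    (∀ e ∈ E, (∑ p : V × V, f p e) ≤ cap e) ∧
    (∀ e ∈ E, e ∉ A → (∑ p : V × V, f p e) = 0)

/-- The traffic matrix `T_E` demanding `cap e` for each edge `e ∈ E` and `0` otherwise. -/
def trafficTE [Fintype V] [DecidableEq V] (E : Finset (V × V)) (cap : V × V → ℚ) :
    V × V → ℚ := fun p => if p ∈ E then cap p else 0

/-- A traffic matrix is a nonnegative function on pairs of vertices. -/
def IsTrafficMatrix (T : V × V → ℚ) : Prop := ∀ p, 0 ≤ T p

/-- The value `v ≥ 0` is achievable from `s` to `t` using only edges from `B`. -/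
def Achievable [Fintype V] [DecidableEq V] (E : Finset (V × V)) (cap : V × V → ℚ)
    (s t : V) (v : ℚ) (B : Finset (V × V)) : Prop :=
  0 ≤ v ∧ ∃ f : V × V → ℚ, IsFlow E s t v f ∧ (∀ e ∈ E, f e ≤ cap e) ∧
    ∀ e, e ∉ B → f e = 0

/-- `B ⊆ E` is a feasible MCPS solution: for every pair `(s, t)` and every value `v`
achievable from `s` to `t` in `E`, the value `β·v` is achievable in `B`. -/
def MCPSFeasible [Fintype V] [DecidableEq V] (E : Finset (V × V)) (cap : V × V → ℚ)
    (β : ℚ) (B : Finset (V × V)) : Prop :=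
  B ⊆ E ∧ ∀ s t : V, ∀ v : ℚ, Achievable E cap s t v E → Achievable E cap s t (β * v) B

section Flows

variable [Fintype V] [DecidableEq V]

/-- For functions supported on `E`, conservation can be stated with sums over all vertices. -/
theorem isFlow_iff (E : Finset (V × V)) (s t : V) (d : ℚ) (f : V × V → ℚ) :
    IsFlow E s t d f ↔ (∀ e, 0 ≤ f e) ∧ (∀ e, e ∉ E → f e = 0) ∧
      ∀ v : V, (∑ u, f (u, v)) - ∑ w, f (v, w) =
        (if v = t then d else 0) - (if v = s then d else 0) := by
  unfold IsFlow
  refine and_congr_right fun _ => and_congr_right fun hE => forall_congr' fun v => ?_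
  have h1 : ∑ e ∈ E.filter (fun e => e.2 = v), f e = ∑ u, f (u, v) := by
    rw [Finset.sum_filter, Finset.sum_subset (Finset.subset_univ E), Fintype.sum_prod_type]
    · simp
    · intro e _ he
      simp [hE e he]
  have h2 : ∑ e ∈ E.filter (fun e => e.1 = v), f e = ∑ w, f (v, w) := by
    rw [Finset.sum_filter, Finset.sum_subset (Finset.subset_univ E), Fintype.sum_prod_type_right]
    · simp
    · intro e _ he
      simp [hE e he]
  rw [h1, h2]

/-- Sending `d` units along a single edge is a flow between its endpoints. -/
theorem isFlow_single (E : Finset (V × V)) (p : V × V) (d : ℚ) (hd : 0 ≤ d)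
    (hp : p ∉ E → d = 0) : IsFlow E p.1 p.2 d (fun e => if e = p then d else 0) := by
  rw [isFlow_iff]
  refine ⟨fun e => ?_, fun e he => ?_, fun v => ?_⟩
  · split_ifs <;> simp [hd]
  · split_ifs with h
    · exact hp (h ▸ he)
    · rfl
  · obtain ⟨x, y⟩ := p
    have h1 : ∑ u, (if (u, v) = (x, y) then d else 0) = if v = y then d else 0 := by
      by_cases h : v = y <;> simp [h]
    have h2 : ∑ w, (if (v, w) = (x, y) then d else 0) = if v = x then d else 0 := by
      by_cases h : v = x <;> simp [h]
    simp only [h1, h2]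

/-- The full capacity of an edge is achievable between its endpoints. -/
theorem achievable_cap (E : Finset (V × V)) (cap : V × V → ℚ) (hcap : ∀ e ∈ E, 0 < cap e)
    (p : V × V) (hp : p ∈ E) : Achievable E cap p.1 p.2 (cap p) E := by
  have hf := isFlow_single E p (cap p) (hcap p hp).le (fun h => absurd hp h)
  refine ⟨(hcap p hp).le, _, hf, fun e he => ?_, hf.2.1⟩
  split_ifs with h
  · rw [h]
  · exact (hcap e he).le

/-- Demanding the capacity of every edge is routable by using every edge for itself. -/
theorem routable_trafficTE (E : Finset (V × V)) (cap : V × V → ℚ)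
    (hcap : ∀ e ∈ E, 0 < cap e) : Routable E cap (trafficTE E cap) E := by
  refine ⟨fun p e => if e = p then trafficTE E cap p else 0, fun p => ?_, fun e he => ?_,
    fun e he h => absurd he h⟩
  · apply isFlow_single
    · unfold trafficTE
      split_ifs with h
      · exact (hcap p h).le
      · rfl
    · intro h
      simp [trafficTE, h]
  · simp [trafficTE, he]

end Flows

/-- The edges of the network on the sink `0`, the hub `1` and `k` sources: every source is joined
to both the sink and the hub, and the hub is joined to the sink. -/
def hubEdges (k : ℕ) : Finset (Fin (k + 2) × Fin (k + 2)) :=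
  univ.filter fun e => e.2 < e.1 ∧ (e.2 = 0 ∨ e.2 = 1)

/-- The `i`-th source of the hub network. -/
def hubSource {k : ℕ} (i : Fin k) : Fin (k + 2) := i.succ.succ

/-- The edges of the hub network from a source straight to the sink. -/
def directEdges (k : ℕ) : Finset (Fin (k + 2) × Fin (k + 2)) :=
  univ.image fun i : Fin k => (hubSource i, 0)

/-- Direct edges have capacity `1`, the edges at the hub have capacity `c`. -/
def hubCap (k : ℕ) (c : ℚ) : Fin (k + 2) × Fin (k + 2) → ℚ :=
  fun e => if e ∈ directEdges k then 1 else c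

section Hub

variable {k : ℕ}

theorem sum_hub {M : Type*} [AddCommMonoid M] (g : Fin (k + 2) → M) :
    ∑ v, g v = g 0 + (g 1 + ∑ i : Fin k, g (hubSource i)) := by
  rw [Fin.sum_univ_succ, Fin.sum_univ_succ]
  rfl

@[elab_as_elim]
theorem hub_cases {P : Fin (k + 2) → Prop} (h0 : P 0) (h1 : P 1)
    (h : ∀ i : Fin k, P (hubSource i)) (v : Fin (k + 2)) : P v := by
  refine Fin.cases h0 (fun w => ?_) v
  exact Fin.cases h1 h w

@[simp] theorem hubSource_inj {i j : Fin k} : hubSource i = hubSource j ↔ i = j := by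
  simp [hubSource]

@[simp] theorem hubSource_ne_zero (i : Fin k) : hubSource i ≠ 0 := by
  simp [hubSource]

@[simp] theorem hubSource_ne_one (i : Fin k) : hubSource i ≠ 1 := by
  intro h
  simpa [hubSource] using congrArg Fin.val h

@[simp] theorem zero_ne_hubSource (i : Fin k) : 0 ≠ hubSource i := (hubSource_ne_zero i).symm

@[simp] theorem one_ne_hubSource (i : Fin k) : 1 ≠ hubSource i := (hubSource_ne_one i).symm

theorem one_lt_hubSource (i : Fin k) : 1 < hubSource i := by
  rw [Fin.lt_def]
  simp [hubSource]

theorem source_sink_mem (i : Fin k) : (hubSource i, 0) ∈ hubEdges k := by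
  simp [hubEdges, Fin.pos_iff_ne_zero]

theorem source_hub_mem (i : Fin k) : (hubSource i, 1) ∈ hubEdges k := by
  simp [hubEdges, one_lt_hubSource]

theorem hub_sink_mem : ((1, 0) : Fin (k + 2) × Fin (k + 2)) ∈ hubEdges k := by
  simp [hubEdges]

theorem sink_out_not_mem (v : Fin (k + 2)) : (0, v) ∉ hubEdges k := by
  simp [hubEdges]

theorem hub_hub_not_mem : ((1, 1) : Fin (k + 2) × Fin (k + 2)) ∉ hubEdges k := by
  simp [hubEdges]

theorem source_in_not_mem (v : Fin (k + 2)) (i : Fin k) : (v, hubSource i) ∉ hubEdges k := by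
  simp [hubEdges]

@[elab_as_elim]
theorem hubEdges_cases {P : Fin (k + 2) × Fin (k + 2) → Prop} (h10 : P (1, 0))
    (h0 : ∀ i : Fin k, P (hubSource i, 0)) (h1 : ∀ i : Fin k, P (hubSource i, 1))
    (e : Fin (k + 2) × Fin (k + 2)) (he : e ∈ hubEdges k) : P e := by
  obtain ⟨x, y⟩ := e
  revert he
  refine hub_cases (fun he => absurd he (sink_out_not_mem y)) ?_ ?_ x
  · refine hub_cases (fun _ => h10) (fun he => absurd he hub_hub_not_mem)
      (fun i he => absurd he (source_in_not_mem _ i)) y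
  · intro j
    refine hub_cases (fun _ => h0 j) (fun _ => h1 j)
      (fun i he => absurd he (source_in_not_mem _ i)) y

theorem source_sink_mem_direct (i : Fin k) : (hubSource i, 0) ∈ directEdges k := by
  simp [directEdges]

theorem source_hub_not_mem_direct (i : Fin k) : (hubSource i, 1) ∉ directEdges k := by
  simp [directEdges]

theorem hub_sink_not_mem_direct : ((1, 0) : Fin (k + 2) × Fin (k + 2)) ∉ directEdges k := by
  simp [directEdges]

theorem hubCap_pos {c : ℚ} (hc : 0 < c) (e : Fin (k + 2) × Fin (k + 2)) : 0 < hubCap k c e := by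
  unfold hubCap
  split_ifs
  · exact one_pos
  · exact hc

/-- A flow in the hub network is given by its values on the three kinds of edges. -/
theorem isFlow_hub_iff (s t : Fin (k + 2)) (d : ℚ) (f : Fin (k + 2) × Fin (k + 2) → ℚ) :
    IsFlow (hubEdges k) s t d f ↔ (∀ e, 0 ≤ f e) ∧ (∀ e, e ∉ hubEdges k → f e = 0) ∧
      f (1, 0) + ∑ i : Fin k, f (hubSource i, 0) =
        (if 0 = t then d else 0) - (if 0 = s then d else 0) ∧
      (∑ i : Fin k, f (hubSource i, 1)) - f (1, 0) =
        (if 1 = t then d else 0) - (if 1 = s then d else 0) ∧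
      ∀ i : Fin k, -(f (hubSource i, 0) + f (hubSource i, 1)) =
        (if hubSource i = t then d else 0) - (if hubSource i = s then d else 0) := by
  rw [isFlow_iff]
  refine and_congr_right fun _ => and_congr_right fun hE => ?_
  have hz (v : Fin (k + 2)) : f (0, v) = 0 := hE _ (sink_out_not_mem v)
  have hh : f (1, 1) = 0 := hE _ hub_hub_not_mem
  have hs (v : Fin (k + 2)) (i : Fin k) : f (v, hubSource i) = 0 :=
    hE _ (source_in_not_mem v i)
  constructor
  · intro h
    refine ⟨?_, ?_, fun i => ?_⟩
    · simpa [sum_hub, hz, hh, hs] using h 0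
    · simpa [sum_hub, hz, hh, hs] using h 1
    · simpa only [sum_hub, hz, hh, hs, Finset.sum_const_zero, add_zero, zero_sub]
        using h (hubSource i)
  · rintro ⟨h0, h1, h⟩
    refine hub_cases ?_ ?_ fun i => ?_
    · simpa [sum_hub, hz, hh, hs] using h0
    · simpa [sum_hub, hz, hh, hs] using h1
    · simpa only [sum_hub, hz, hh, hs, Finset.sum_const_zero, add_zero, zero_sub] using h i

/-- A source other than the origin of the flow sends nothing. -/
theorem IsFlow.source_eq_zero {s t : Fin (k + 2)} {d : ℚ} {f : Fin (k + 2) × Fin (k + 2) → ℚ}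
    (hf : IsFlow (hubEdges k) s t d f) (hd : 0 ≤ d) {i : Fin k} (hi : hubSource i ≠ s) :
    f (hubSource i, 0) = 0 := by
  rw [isFlow_hub_iff] at hf
  obtain ⟨hpos, -, -, -, h⟩ := hf
  have h' := h i
  rw [if_neg hi] at h'
  have : 0 ≤ if hubSource i = t then d else 0 := by split_ifs <;> simp [hd]
  linarith [hpos (hubSource i, 0), hpos (hubSource i, 1)]

/-- The direct edges can carry at most one unit of a single-commodity flow in total. -/
theorem IsFlow.sum_direct_le {s t : Fin (k + 2)} {d c : ℚ}
    {f : Fin (k + 2) × Fin (k + 2) → ℚ}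
    (hf : IsFlow (hubEdges k) s t d f) (hd : 0 ≤ d)
    (hcap : ∀ e ∈ hubEdges k, f e ≤ hubCap k c e) :
    ∑ i : Fin k, f (hubSource i, 0) ≤ 1 := by
  by_cases h : ∃ j : Fin k, hubSource j = s
  · obtain ⟨j, rfl⟩ := h
    rw [Finset.sum_eq_single j]
    · simpa [hubCap, source_sink_mem_direct] using hcap _ (source_sink_mem j)
    · intro i _ hij
      exact hf.source_eq_zero hd (by simpa using hij)
    · simp
  · push Not at h
    rw [Finset.sum_eq_zero fun i _ => hf.source_eq_zero hd (h i)]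
    exact zero_le_one

/-- Rerouting the direct edges through the hub. -/
theorem mcpsFeasible_sdiff {c β : ℚ} (hβ : 0 ≤ β) (hβc : β * (1 + c) ≤ c) :
    MCPSFeasible (hubEdges k) (hubCap k c) β (hubEdges k \ directEdges k) := by
  refine ⟨Finset.sdiff_subset, ?_⟩
  rintro s t v ⟨hv, f, hf, hcap, -⟩
  have hsum := hf.sum_direct_le hv hcap
  obtain ⟨hpos, -, h0, h1, h⟩ := (isFlow_hub_iff _ _ _ _).1 hf
  let g : Fin (k + 2) × Fin (k + 2) → ℚ := fun e =>
    if e ∈ hubEdges k \ directEdges k then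
      β * (f e + if e.2 = 1 then f (e.1, 0) else ∑ i : Fin k, f (hubSource i, 0))
    else 0
  have g10 : g (1, 0) = β * (f (1, 0) + ∑ i : Fin k, f (hubSource i, 0)) := by
    simp [g, hub_sink_mem, hub_sink_not_mem_direct]
  have gi0 (i : Fin k) : g (hubSource i, 0) = 0 := by
    simp [g, source_sink_mem_direct]
  have gi1 (i : Fin k) :
      g (hubSource i, 1) = β * (f (hubSource i, 1) + f (hubSource i, 0)) := by
    simp [g, source_hub_mem, source_hub_not_mem_direct]
  have hmul (p q : Prop) [Decidable p] [Decidable q] :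
      (if p then β * v else 0) - (if q then β * v else 0) =
        β * ((if p then v else 0) - (if q then v else 0)) := by
    split_ifs <;> ring
  refine ⟨mul_nonneg hβ hv, g, (isFlow_hub_iff _ _ _ _).2 ⟨fun e => ?_, fun e he => ?_, ?_, ?_, ?_⟩,
    ?_, fun e he => if_neg he⟩
  · dsimp only [g]
    split_ifs
    · exact mul_nonneg hβ (add_nonneg (hpos _) (hpos _))
    · exact mul_nonneg hβ (add_nonneg (hpos _) (Finset.sum_nonneg fun i _ => hpos _))
    · rfl
  · exact if_neg fun h => he (Finset.mem_sdiff.1 h).1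
  · rw [hmul, ← h0, g10]
    simp [gi0]
  · rw [hmul, ← h1, g10]
    simp only [gi1, ← Finset.mul_sum, Finset.sum_add_distrib]
    ring
  · intro i
    rw [hmul, ← h i, gi0, gi1]
    ring
  · have hle {x y : ℚ} (hx : x ≤ c) (hy : y ≤ 1) : β * (x + y) ≤ c :=
      (mul_le_mul_of_nonneg_left (by linarith) hβ).trans hβc
    refine hubEdges_cases ?_ (fun i => ?_) fun i => ?_
    · have := hcap _ hub_sink_mem
      rw [hubCap, if_neg hub_sink_not_mem_direct] at this ⊢
      rw [g10]
      exact hle this hsum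
    · rw [gi0, hubCap, if_pos (source_sink_mem_direct i)]
      exact zero_le_one
    · have h1 := hcap _ (source_hub_mem i)
      have h0 := hcap _ (source_sink_mem i)
      rw [hubCap, if_neg (source_hub_not_mem_direct i)] at h1 ⊢
      rw [hubCap, if_pos (source_sink_mem_direct i)] at h0
      rw [gi1]
      exact hle h1 h0

/-- Every feasible solution keeps all edges at the hub. -/
theorem sdiff_subset_of_mcpsFeasible {c β : ℚ} (hβ : 0 < β) (hc : 0 < c)
    {B : Finset (Fin (k + 2) × Fin (k + 2))}
    (hB : MCPSFeasible (hubEdges k) (hubCap k c) β B) :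
    hubEdges k \ directEdges k ⊆ B := by
  intro e he
  obtain ⟨heE, heD⟩ := Finset.mem_sdiff.1 he
  have hpos : 0 < β * hubCap k c e := mul_pos hβ (hubCap_pos hc e)
  obtain ⟨-, f, hf, -, hfB⟩ := hB.2 _ _ _
    (achievable_cap (hubEdges k) (hubCap k c) (fun e _ => hubCap_pos hc e) e heE)
  by_contra heB
  have hfe := hfB e heB
  generalize β * hubCap k c e = d at hpos hf
  revert heD hfe hf
  refine hubEdges_cases ?_ (fun i => ?_) (fun i => ?_) e heE
  · intro _ hfe hf
    have hz : ∑ i : Fin k, f (hubSource i, 0) = 0 :=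
      Finset.sum_eq_zero fun i _ => hf.source_eq_zero hpos.le (hubSource_ne_one i)
    obtain ⟨-, -, h0, -, -⟩ := (isFlow_hub_iff _ _ _ _).1 hf
    simp [hz, hfe] at h0
    exact hpos.ne h0
  · intro h
    exact absurd (source_sink_mem_direct i) h
  · intro _ hfe hf
    obtain ⟨hnn, -, h0, -, h⟩ := (isFlow_hub_iff _ _ _ _).1 hf
    have hi := h i
    simp [hfe] at hi h0
    have := Finset.single_le_sum (f := fun i : Fin k => f (hubSource i, 0))
      (fun j _ => hnn _) (Finset.mem_univ i)
    linarith [hnn (1, 0)]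

/-- Without the direct edges, all the demands of the sources must share the hub. -/
theorem not_routable_sdiff {c α : ℚ} (hkc : c < k * α) :
    ¬ Routable (hubEdges k) (hubCap k c)
      (fun p => α * trafficTE (hubEdges k) (hubCap k c) p) (hubEdges k \ directEdges k) := by
  rintro ⟨f, hf, hcap, hoff⟩
  have hα (i : Fin k) : f (hubSource i, 0) (1, 0) = α := by
    have hz (j : Fin k) : f (hubSource i, 0) (hubSource j, 0) = 0 := by
      have := hoff (hubSource j, 0) (source_sink_mem j) (by simp [source_sink_mem_direct])
      rw [Finset.sum_eq_zero_iff_of_nonneg fun p _ => (hf p).1 _] at this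
      exact this _ (Finset.mem_univ _)
    obtain ⟨-, -, h0, -, -⟩ := (isFlow_hub_iff _ _ _ _).1 (hf (hubSource i, 0))
    simpa [hz, trafficTE, source_sink_mem, hubCap, source_sink_mem_direct] using h0
  have hle := hcap _ hub_sink_mem
  rw [hubCap, if_neg hub_sink_not_mem_direct] at hle
  have hsub : ∑ p ∈ directEdges k, f p (1, 0) ≤ ∑ p, f p (1, 0) :=
    Finset.sum_le_sum_of_subset_of_nonneg (Finset.subset_univ _) fun p _ _ => (hf p).1 _
  have himg : ∑ p ∈ directEdges k, f p (1, 0) = k * α := by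
    rw [directEdges, Finset.sum_image (by intro i _ j _ h; simpa using h)]
    simp [hα]
  linarith

end Hub

theorem stmt8 (α β : ℚ) (hα0 : 0 < α) (hα1 : α < 1) (hβ0 : 0 < β) (hβ1 : β < 1) :
    ∃ (n : ℕ) (E : Finset (Fin n × Fin n)) (cap : Fin n × Fin n → ℚ)
      (T : Fin n × Fin n → ℚ),
      (∀ e ∈ E, e.1 ≠ e.2) ∧ (∀ e ∈ E, 0 < cap e) ∧ IsTrafficMatrix T ∧
      Routable E cap T E ∧
      ∀ E' ⊆ E, MCPSFeasible E cap β E' →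
        (∀ B ⊆ E, MCPSFeasible E cap β B → E'.card ≤ B.card) →
        ¬ Routable E cap (fun p => α * T p) E' := by
  have hβ : 0 < 1 - β := by linarith
  obtain ⟨c, hc, hβc⟩ : ∃ c : ℚ, 0 < c ∧ β * (1 + c) = c :=
    ⟨β / (1 - β), div_pos hβ0 hβ, by field_simp; ring⟩
  obtain ⟨k, hk⟩ := exists_nat_gt (c / α)
  rw [div_lt_iff₀ hα0] at hk
  refine ⟨k + 2, hubEdges k, hubCap k c, trafficTE (hubEdges k) (hubCap k c), fun e he => ?_,
    fun e _ => hubCap_pos hc e, fun p => ?_,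
    routable_trafficTE _ _ fun e _ => hubCap_pos hc e, fun E' _ hE' hmin => ?_⟩
  · simp only [hubEdges, Finset.mem_filter] at he
    exact he.2.1.ne'
  · unfold trafficTE
    split_ifs
    · exact (hubCap_pos hc p).le
    · rfl
  · rw [← Finset.eq_of_subset_of_card_le (sdiff_subset_of_mcpsFeasible hβ0 hc hE')
      (hmin _ Finset.sdiff_subset (mcpsFeasible_sdiff hβ0.le hβc.le))]
    exact not_routable_sdiff hk
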